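/- arXiv:1302.5889 — 3 statements merged into one kernel-verified Lean document; each statement's English description precedes it below -/
import Mathlib

section
/- Let G be a partial 2-tree that is not outerplanar. Then there exists a K_{2,3}-subdivision in G, with branch vertices {u,v} on the side of size two and {x,y,z} on the side of size three, such that G − {u,v} has at least three connected components. -/
/-!
Common definitions for formalizing "Minimum Cycle Basis in Weighted Partial 2-trees".
-/

namespace LexMCB

open SimpleGraph

variable {V : Type*}

/-- The weight of a walk: the sum of the weights of its edges. -/
def walkWeight {G : SimpleGraph V} (w : Sym2 V → ℕ) {a b : V} (p : G.Walk a b) : ℕ :=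
  (p.edges.map w).sum

/-- A walk is contained in the subgraph described by vertex set `V₁` and edge set `E₁`. -/
def WalkIn {G : SimpleGraph V} (V₁ : Set V) (E₁ : Set (Sym2 V)) {a b : V}
    (p : G.Walk a b) : Prop :=
  (∀ t ∈ p.support, t ∈ V₁) ∧ ∀ e ∈ p.edges, e ∈ E₁

/-- `p` is lexicographically better than `q`: either it has smaller weight, or equal weight
and fewer edges, or equal weight and equally many edges and
`min (V(q) \ V(p)) > min (V(p) \ V(q))`. -/
def LexBetter [LinearOrder V] {G : SimpleGraph V} (w : Sym2 V → ℕ) {a b : V}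
    (p q : G.Walk a b) : Prop :=
  walkWeight w p < walkWeight w q ∨
    (walkWeight w q = walkWeight w p ∧ p.length < q.length) ∨
    (walkWeight w q = walkWeight w p ∧ q.length = p.length ∧
      (p.support.toFinset \ q.support.toFinset).min <
        (q.support.toFinset \ p.support.toFinset).min)

/-- `p` is the lex shortest path between its endpoints among the paths lying in the
subgraph described by vertex set `V₁` and edge set `E₁`. -/
def IsLexShortestPathIn [LinearOrder V] {G : SimpleGraph V} (w : Sym2 V → ℕ)
    (V₁ : Set V) (E₁ : Set (Sym2 V)) {a b : V} (p : G.Walk a b) : Prop :=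
  p.IsPath ∧ WalkIn V₁ E₁ p ∧
    ∀ q : G.Walk a b, q.IsPath → WalkIn V₁ E₁ q → q ≠ p → LexBetter w p q

/-- `p` is the lex shortest path of `G` between its endpoints. -/
def IsLexShortestPath [LinearOrder V] {G : SimpleGraph V} (w : Sym2 V → ℕ)
    {a b : V} (p : G.Walk a b) : Prop :=
  IsLexShortestPathIn w Set.univ G.edgeSet p

/-- A (sub)graph is a cycle: it is connected and every vertex has degree two. -/
def IsCycleSubgraph {G : SimpleGraph V} (C : G.Subgraph) : Prop :=
  C.Connected ∧ ∀ t ∈ C.verts, (C.neighborSet t).ncard = 2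

/-- `C` is a lex short cycle of the subgraph of `G` described by vertex set `V₁` and
edge set `E₁`: it is a cycle lying there, and for any two distinct vertices `x,y` of `C`
the lex shortest `x`-`y` path of that subgraph is contained in `C`. -/
def IsLexShortCycleIn [LinearOrder V] {G : SimpleGraph V} (w : Sym2 V → ℕ)
    (V₁ : Set V) (E₁ : Set (Sym2 V)) (C : G.Subgraph) : Prop :=
  C.verts ⊆ V₁ ∧ C.edgeSet ⊆ E₁ ∧ IsCycleSubgraph C ∧
    ∀ x ∈ C.verts, ∀ y ∈ C.verts, x ≠ y →
      ∀ p : G.Walk x y, IsLexShortestPathIn w V₁ E₁ p → ∀ e ∈ p.edges, e ∈ C.edgeSet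

/-- The set of lex short cycles of the subgraph of `G` described by `V₁`, `E₁`. -/
def LSCIn [LinearOrder V] (G : SimpleGraph V) (w : Sym2 V → ℕ)
    (V₁ : Set V) (E₁ : Set (Sym2 V)) : Set G.Subgraph :=
  {C | IsLexShortCycleIn w V₁ E₁ C}

/-- The set of lex short cycles of `G`. -/
def LSC [LinearOrder V] (G : SimpleGraph V) (w : Sym2 V → ℕ) : Set G.Subgraph :=
  LSCIn G w Set.univ G.edgeSet

/-! ### Components and separators -/

/-- The edges of `G` lying within the vertex set `H`. -/
def edgesWithin (G : SimpleGraph V) (H : Set V) : Set (Sym2 V) :=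
  {e | e ∈ G.edgeSet ∧ ∀ t ∈ e, t ∈ H}

/-- `H` is (the vertex set of) a connected component of the induced subgraph `G[A]`:
it is a maximal subset of `A` inducing a connected subgraph. -/
def IsComponentOf (G : SimpleGraph V) (A : Set V) (H : Set V) : Prop :=
  H.Nonempty ∧ H ⊆ A ∧ (G.induce H).Connected ∧
    ∀ K : Set V, H ⊆ K → K ⊆ A → (G.induce K).Connected → K = H

/-- `{u, v}` is a vertex separator of `G` : deleting `u` and `v` disconnects `G`. -/
def IsSeparatorPair (G : SimpleGraph V) (u v : V) : Prop :=
  ¬ (G.induce {t | t ≠ u ∧ t ≠ v}).Connected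

/-- The number of connected components of `G - {u, v}`. -/
noncomputable def numComponentsDel (G : SimpleGraph V) (u v : V) : ℕ :=
  Nat.card ((G.induce {t | t ≠ u ∧ t ≠ v}).ConnectedComponent)

/-! ### Subdivisions of `K₄` and `K_{2,3}`, outerplanarity -/

/-- The interior (internal vertices) of a walk. -/
def walkInterior {G : SimpleGraph V} {a b : V} (p : G.Walk a b) : Set V :=
  {t | t ∈ p.support} \ {a, b}

/-- A `K_{2,3}`-subdivision in `G` with branch vertices `u, v` (the side of size two)
and `x, y, z` (the side of size three): six internally disjoint paths joining each of
`u, v` to each of `x, y, z`, whose interiors avoid the branch vertices. -/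
structure K23Subdiv (G : SimpleGraph V) (u v x y z : V) where
  pux : G.Walk u x
  puy : G.Walk u y
  puz : G.Walk u z
  pvx : G.Walk v x
  pvy : G.Walk v y
  pvz : G.Walk v z
  branch_nodup : List.Pairwise (· ≠ ·) [u, v, x, y, z]
  isPath_pux : pux.IsPath
  isPath_puy : puy.IsPath
  isPath_puz : puz.IsPath
  isPath_pvx : pvx.IsPath
  isPath_pvy : pvy.IsPath
  isPath_pvz : pvz.IsPath
  interiors_disjoint : List.Pairwise Disjoint
    [walkInterior pux, walkInterior puy, walkInterior puz,
     walkInterior pvx, walkInterior pvy, walkInterior pvz]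
  interiors_avoid_branch : ∀ s ∈ [walkInterior pux, walkInterior puy, walkInterior puz,
      walkInterior pvx, walkInterior pvy, walkInterior pvz],
    ∀ t ∈ s, t ∉ ({u, v, x, y, z} : Set V)

/-- The vertex set of a `K_{2,3}`-subdivision. -/
def K23Subdiv.vertSet {G : SimpleGraph V} {u v x y z : V} (K : K23Subdiv G u v x y z) :
    Set V :=
  {t | t ∈ K.pux.support ∨ t ∈ K.puy.support ∨ t ∈ K.puz.support ∨
       t ∈ K.pvx.support ∨ t ∈ K.pvy.support ∨ t ∈ K.pvz.support}

/-- The edge set of a `K_{2,3}`-subdivision. -/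
def K23Subdiv.edges {G : SimpleGraph V} {u v x y z : V} (K : K23Subdiv G u v x y z) :
    Set (Sym2 V) :=
  {e | e ∈ K.pux.edges ∨ e ∈ K.puy.edges ∨ e ∈ K.puz.edges ∨
       e ∈ K.pvx.edges ∨ e ∈ K.pvy.edges ∨ e ∈ K.pvz.edges}

/-- `G` contains a subdivision of `K_{2,3}`. -/
def HasK23Subdivision (G : SimpleGraph V) : Prop :=
  ∃ u v x y z : V, Nonempty (K23Subdiv G u v x y z)

/-- The subgraph `S` of `G` is (exactly) a `K_{2,3}`-subdivision. -/
def IsK23SubdivisionSubgraph {G : SimpleGraph V} (S : G.Subgraph) : Prop :=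
  ∃ (u v x y z : V) (K : K23Subdiv G u v x y z),
    K.vertSet = S.verts ∧ K.edges = S.edgeSet

/-- A `K₄`-subdivision in `G` with branch vertices `a, b, c, d`. -/
structure K4Subdiv (G : SimpleGraph V) (a b c d : V) where
  pab : G.Walk a b
  pac : G.Walk a c
  pad : G.Walk a d
  pbc : G.Walk b c
  pbd : G.Walk b d
  pcd : G.Walk c d
  branch_nodup : List.Pairwise (· ≠ ·) [a, b, c, d]
  isPath_pab : pab.IsPath
  isPath_pac : pac.IsPath
  isPath_pad : pad.IsPath
  isPath_pbc : pbc.IsPath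
  isPath_pbd : pbd.IsPath
  isPath_pcd : pcd.IsPath
  interiors_disjoint : List.Pairwise Disjoint
    [walkInterior pab, walkInterior pac, walkInterior pad,
     walkInterior pbc, walkInterior pbd, walkInterior pcd]
  interiors_avoid_branch : ∀ s ∈ [walkInterior pab, walkInterior pac, walkInterior pad,
      walkInterior pbc, walkInterior pbd, walkInterior pcd],
    ∀ t ∈ s, t ∉ ({a, b, c, d} : Set V)

/-- `G` contains a subdivision of `K₄`. -/
def HasK4Subdivision (G : SimpleGraph V) : Prop :=
  ∃ a b c d : V, Nonempty (K4Subdiv G a b c d)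

/-- `G` is outerplanar.  (We use the classical combinatorial characterization:
a graph is outerplanar iff it has no subgraph that is a subdivision of `K₄` or of
`K_{2,3}`.) -/
def IsOuterplanar (G : SimpleGraph V) : Prop :=
  ¬ HasK4Subdivision G ∧ ¬ HasK23Subdivision G

/-! ### 2-trees and partial 2-trees -/

/-- Add to `G` a new vertex adjacent to (exactly) `a` and `b`. -/
def addVertexOnEdge {n : ℕ} (G : SimpleGraph (Fin n)) (a b : Fin n) :
    SimpleGraph (Fin (n + 1)) :=
  SimpleGraph.fromRel fun i j =>
    (∃ i' j' : Fin n, i = Fin.castSucc i' ∧ j = Fin.castSucc j' ∧ G.Adj i' j') ∨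
    (i = Fin.last n ∧ (j = Fin.castSucc a ∨ j = Fin.castSucc b))

/-- 2-trees, defined inductively: `K₃` is a 2-tree, and adding a new vertex whose
neighbourhood is an edge of a 2-tree again gives a 2-tree. -/
inductive IsTwoTree : ∀ {n : ℕ}, SimpleGraph (Fin n) → Prop
  | base : IsTwoTree (⊤ : SimpleGraph (Fin 3))
  | extend {n : ℕ} (G : SimpleGraph (Fin n)) (a b : Fin n) :
      IsTwoTree G → G.Adj a b → IsTwoTree (addVertexOnEdge G a b)

/-- A partial 2-tree: a subgraph of a 2-tree. -/
def IsPartialTwoTree {W : Type*} (G : SimpleGraph W) : Prop :=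
  ∃ (n : ℕ) (T : SimpleGraph (Fin n)) (f : W ↪ Fin n),
    IsTwoTree T ∧ ∀ x y : W, G.Adj x y → T.Adj (f x) (f y)

/-! ### The cycle space over `𝔽₂`, cycle bases and minimum cycle bases -/

/-- The incidence vector (over `𝔽₂`) of a subgraph, indexed by `Sym2 V`. -/
noncomputable def cycleIncVec {G : SimpleGraph V} (C : G.Subgraph) : Sym2 V → ZMod 2 :=
  C.edgeSet.indicator fun _ => 1

/-- The cycle space of `G`: the span over `𝔽₂` of the incidence vectors of cycles. -/
def cycleSpace (G : SimpleGraph V) : Submodule (ZMod 2) (Sym2 V → ZMod 2) :=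
  Submodule.span (ZMod 2) (cycleIncVec '' {C : G.Subgraph | IsCycleSubgraph C})

/-- `B` is a cycle basis of `G`: a minimum-cardinality set of cycles whose incidence
vectors span the cycle space of `G`. -/
def IsCycleBasis (G : SimpleGraph V) (B : Set G.Subgraph) : Prop :=
  (∀ C ∈ B, IsCycleSubgraph C) ∧
    Submodule.span (ZMod 2) (cycleIncVec '' B) = cycleSpace G ∧
    ∀ B' : Set G.Subgraph, (∀ C ∈ B', IsCycleSubgraph C) →
      Submodule.span (ZMod 2) (cycleIncVec '' B') = cycleSpace G → B.ncard ≤ B'.ncard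

/-- The weight of a cycle: the sum of the weights of its edges. -/
noncomputable def cycleWeight {G : SimpleGraph V} (w : Sym2 V → ℕ) (C : G.Subgraph) : ℕ :=
  ∑ᶠ e ∈ C.edgeSet, w e

/-- The total weight of a set of cycles. -/
noncomputable def basisWeight {G : SimpleGraph V} (w : Sym2 V → ℕ)
    (B : Set G.Subgraph) : ℕ :=
  ∑ᶠ C ∈ B, cycleWeight w C

/-- `B` is a minimum cycle basis of `G`: a cycle basis of minimum total weight. -/
def IsMinimumCycleBasis (G : SimpleGraph V) (w : Sym2 V → ℕ) (B : Set G.Subgraph) : Prop :=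
  IsCycleBasis G B ∧ ∀ B' : Set G.Subgraph, IsCycleBasis G B' →
    basisWeight w B ≤ basisWeight w B'

/-! ### The `decomp` operation -/

/-- The vertex set of the first part `G₁` of `decomp(G,u,v)`. -/
def decompVerts1 {G : SimpleGraph V} {u v : V} (P : G.Walk u v) (H : Set V) : Set V :=
  H ∪ {t | t ∈ P.support}

/-- The edge set of the first part `G₁` of `decomp(G,u,v)`:
`E(H) ∪ E(lsp(u,v)) ∪ {(x,y) : x ∈ V(H), y ∈ {u,v}, (x,y) ∈ E(G)}`. -/
def decompEdges1 {G : SimpleGraph V} {u v : V} (P : G.Walk u v) (H : Set V) :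
    Set (Sym2 V) :=
  edgesWithin G H ∪ {e | e ∈ P.edges} ∪
    {e | ∃ a ∈ H, ∃ c ∈ ({u, v} : Set V), G.Adj a c ∧ e = s(a, c)}

/-! ### Connected sets and `K₄`-minors -/

/-- `B` is connected in `G`: every partition of `B` into two nonempty parts is crossed by an
edge. -/
def CutConnected (G : SimpleGraph V) (B : Set V) : Prop :=
  ∀ S ⊆ B, S.Nonempty → (B \ S).Nonempty → ∃ s ∈ S, ∃ r ∈ B \ S, G.Adj s r

/-- Some edge of `G` joins `A` to `B`. -/
def Touches (G : SimpleGraph V) (A B : Set V) : Prop :=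
  ∃ s ∈ A, ∃ t ∈ B, G.Adj s t

/-- Four pairwise disjoint connected sets, any two of which are joined by an edge. -/
structure IsK4Model (G : SimpleGraph V) (B : Fin 4 → Set V) : Prop where
  nonempty : ∀ i, (B i).Nonempty
  conn : ∀ i, CutConnected G (B i)
  disjoint : ∀ i j, i ≠ j → Disjoint (B i) (B j)
  touches : ∀ i j, i ≠ j → Touches G (B i) (B j)

theorem Touches.symm {G : SimpleGraph V} {A B : Set V} (h : Touches G A B) : Touches G B A := by
  obtain ⟨s, hs, t, ht, hst⟩ := h
  exact ⟨t, ht, s, hs, hst.symm⟩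

theorem Touches.mono {G : SimpleGraph V} {A B A' B' : Set V} (h : Touches G A B)
    (hA : A ⊆ A') (hB : B ⊆ B') : Touches G A' B' := by
  obtain ⟨s, hs, t, ht, hst⟩ := h
  exact ⟨s, hA hs, t, hB ht, hst⟩

theorem cutConnected_singleton (G : SimpleGraph V) (a : V) : CutConnected G {a} := by
  rintro S hS ⟨s, hs⟩ ⟨r, hr, hrS⟩
  have hs' : s = a := hS hs
  have hr' : r = a := hr
  exact absurd (hr' ▸ hs' ▸ hs) hrS

/-- A connected set that meets `S` and has no edge leaving `S` inside it is contained in `S`. -/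
theorem CutConnected.subset_of_closed {G : SimpleGraph V} {A S : Set V} (hA : CutConnected G A)
    {x : V} (hx : x ∈ A) (hxS : x ∈ S)
    (hS : ∀ s ∈ S, ∀ r ∈ A, G.Adj s r → r ∈ S) : A ⊆ S := by
  by_contra hne
  obtain ⟨r, hr, hrS⟩ := Set.not_subset.1 hne
  obtain ⟨s, hs, t, ht, hst⟩ := hA (A ∩ S) Set.inter_subset_left ⟨x, hx, hxS⟩
    ⟨r, hr, fun h => hrS h.2⟩
  exact ht.2 ⟨ht.1, hS s hs.2 t ht.1 hst⟩

theorem CutConnected.union_of_touches {G : SimpleGraph V} {A B : Set V}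
    (hA : CutConnected G A) (hB : CutConnected G B) (h : Touches G A B) :
    CutConnected G (A ∪ B) := by
  intro S hS hSne hSc
  by_contra hno
  push Not at hno
  obtain ⟨a, ha, b, hb, hab⟩ := h
  have closed : ∀ s ∈ S, ∀ r ∈ A ∪ B, G.Adj s r → r ∈ S := by
    intro s hs r hr hsr
    by_contra hrS
    exact hno s hs r ⟨hr, hrS⟩ hsr
  have key : A ⊆ S ∧ B ⊆ S := by
    obtain ⟨s, hs⟩ := hSne
    rcases hS hs with hsA | hsB
    · have hAS := hA.subset_of_closed hsA hs fun s hs r hr => closed s hs r (Or.inl hr)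
      exact ⟨hAS, hB.subset_of_closed hb (closed a (hAS ha) b (Or.inr hb) hab)
        fun s hs r hr => closed s hs r (Or.inr hr)⟩
    · have hBS := hB.subset_of_closed hsB hs fun s hs r hr => closed s hs r (Or.inr hr)
      exact ⟨hA.subset_of_closed ha (closed b (hBS hb) a (Or.inl ha) hab.symm)
        fun s hs r hr => closed s hs r (Or.inl hr), hBS⟩
  obtain ⟨r, hr, hrS⟩ := hSc
  exact hrS (hr.elim (fun h => key.1 h) fun h => key.2 h)

theorem CutConnected.union_of_mem {G : SimpleGraph V} {A B : Set V} {x : V}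
    (hA : CutConnected G A) (hB : CutConnected G B) (hxA : x ∈ A) (hxB : x ∈ B) :
    CutConnected G (A ∪ B) := by
  intro S hS hSne hSc
  by_contra hno
  push Not at hno
  have closed : ∀ s ∈ S, ∀ r ∈ A ∪ B, G.Adj s r → r ∈ S := by
    intro s hs r hr hsr
    by_contra hrS
    exact hno s hs r ⟨hr, hrS⟩ hsr
  have hclA : ∀ y ∈ A, y ∈ S → A ⊆ S := fun y hy hyS =>
    hA.subset_of_closed hy hyS fun s hs r hr => closed s hs r (Or.inl hr)
  have hclB : ∀ y ∈ B, y ∈ S → B ⊆ S := fun y hy hyS =>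
    hB.subset_of_closed hy hyS fun s hs r hr => closed s hs r (Or.inr hr)
  have hxS : x ∈ S := by
    obtain ⟨s, hs⟩ := hSne
    exact (hS hs).elim (fun h => hclA s h hs hxA) fun h => hclB s h hs hxB
  obtain ⟨r, hr, hrS⟩ := hSc
  exact hrS (hr.elim (fun h => hclA x hxA hxS h) fun h => hclB x hxB hxS h)

theorem CutConnected.image {W : Type*} {G : SimpleGraph V} {H : SimpleGraph W} {f : V → W}
    (hf : ∀ x y, G.Adj x y → H.Adj (f x) (f y)) {B : Set V} (hB : CutConnected G B) :
    CutConnected H (f '' B) := by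
  rintro S hS ⟨_, hs⟩ ⟨_, ⟨r, hr, rfl⟩, hrS⟩
  obtain ⟨s, hsB, rfl⟩ := hS hs
  obtain ⟨a, ha, b, hb, hab⟩ := hB (B ∩ f ⁻¹' S) Set.inter_subset_left ⟨s, hsB, hs⟩
    ⟨r, hr, fun h => hrS h.2⟩
  exact ⟨f a, ha.2, f b, ⟨⟨b, hb.1, rfl⟩, fun h => hb.2 ⟨hb.1, h⟩⟩, hf a b hab⟩

theorem IsK4Model.image {W : Type*} {G : SimpleGraph V} {H : SimpleGraph W} (f : V ↪ W)
    (hf : ∀ x y, G.Adj x y → H.Adj (f x) (f y)) {B : Fin 4 → Set V} (hB : IsK4Model G B) :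
    IsK4Model H fun i => f '' B i where
  nonempty i := (hB.nonempty i).image f
  conn i := (hB.conn i).image hf
  disjoint i j hij := (Set.disjoint_image_iff f.injective).2 (hB.disjoint i j hij)
  touches i j hij := by
    obtain ⟨s, hs, t, ht, hst⟩ := hB.touches i j hij
    exact ⟨f s, ⟨s, hs, rfl⟩, f t, ⟨t, ht, rfl⟩, hf s t hst⟩

/-! ### Partial 2-trees have no `K₄`-minor -/

theorem addVertexOnEdge_adj_castSucc {n : ℕ} {G : SimpleGraph (Fin n)} {a b s t : Fin n} :
    (addVertexOnEdge G a b).Adj s.castSucc t.castSucc ↔ G.Adj s t := by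
  simp only [addVertexOnEdge, SimpleGraph.fromRel_adj, Fin.castSucc_inj,
    (Fin.castSucc_lt_last _).ne, false_and, or_false, ne_eq]
  constructor
  · rintro ⟨-, ⟨i, j, rfl, rfl, h⟩ | ⟨i, j, rfl, rfl, h⟩⟩
    exacts [h, h.symm]
  · exact fun h => ⟨h.ne, Or.inl ⟨s, t, rfl, rfl, h⟩⟩

theorem addVertexOnEdge_adj_last {n : ℕ} {G : SimpleGraph (Fin n)} {a b : Fin n}
    {t : Fin (n + 1)} (h : (addVertexOnEdge G a b).Adj (Fin.last n) t) :
    t = a.castSucc ∨ t = b.castSucc := by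
  simp only [addVertexOnEdge, SimpleGraph.fromRel_adj] at h
  obtain ⟨hne, (⟨i, j, hi, -⟩ | ⟨-, h⟩) | (⟨i, j, -, hj, -⟩ | ⟨ht, -⟩)⟩ := h
  · exact absurd hi.symm (Fin.castSucc_lt_last i).ne
  · exact h
  · exact absurd hj.symm (Fin.castSucc_lt_last j).ne
  · exact absurd ht.symm hne

theorem CutConnected.preimage_castSucc {n : ℕ} {G : SimpleGraph (Fin n)} {a b : Fin n}
    (hab : G.Adj a b) {B : Set (Fin (n + 1))} (hB : CutConnected (addVertexOnEdge G a b) B) :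
    CutConnected G (Fin.castSucc ⁻¹' B) := by
  intro S hS hSne hSc
  by_contra hno
  push Not at hno
  obtain ⟨s₀, hs₀⟩ := hSne
  obtain ⟨r₀, hr₀, hr₀S⟩ := hSc
  have hlast : Fin.last n ∈ B ∧ ∃ r ∈ Fin.castSucc ⁻¹' B \ S,
      (addVertexOnEdge G a b).Adj (Fin.last n) r.castSucc := by
    obtain ⟨s, hs, r, ⟨hrB, hr⟩, hsr⟩ := hB (B ∩ ({Fin.last n} ∪ Fin.castSucc '' S))
      Set.inter_subset_left ⟨s₀.castSucc, hS hs₀, Or.inr ⟨s₀, hs₀, rfl⟩⟩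
      ⟨r₀.castSucc, hr₀, by simpa [(Fin.castSucc_lt_last r₀).ne] using fun _ => hr₀S⟩
    have hrl : r ≠ Fin.last n := fun h => hr ⟨hrB, Or.inl h⟩
    obtain ⟨r, rfl⟩ := Fin.exists_castSucc_eq.2 hrl
    have hrS : r ∉ S := fun h => hr ⟨hrB, Or.inr ⟨r, h, rfl⟩⟩
    rcases hs with ⟨hsB, rfl | ⟨s, hs, rfl⟩⟩
    · exact ⟨hsB, r, ⟨hrB, hrS⟩, hsr⟩
    · exact absurd (addVertexOnEdge_adj_castSucc.1 hsr) (hno s hs r ⟨hrB, hrS⟩)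
  obtain ⟨hl, r, hr, hlr⟩ := hlast
  obtain ⟨s, ⟨s, hs, rfl⟩, t, ⟨htB, ht⟩, hst⟩ := hB (Fin.castSucc '' S)
    (by rintro _ ⟨s, hs, rfl⟩; exact hS hs) ⟨_, s₀, hs₀, rfl⟩
    ⟨_, hl, by rintro ⟨s, -, hs⟩; exact (Fin.castSucc_lt_last s).ne hs⟩
  by_cases htl : t = Fin.last n
  · subst htl
    have hsr : s ≠ r := fun h => hr.2 (h ▸ hs)
    have h1 := addVertexOnEdge_adj_last hst.symm
    have h2 := addVertexOnEdge_adj_last hlr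
    simp only [Fin.castSucc_inj] at h1 h2
    apply hno s hs r hr
    rcases h1 with rfl | rfl <;> rcases h2 with rfl | rfl
    exacts [absurd rfl hsr, hab, hab.symm, absurd rfl hsr]
  · obtain ⟨t, rfl⟩ := Fin.exists_castSucc_eq.2 htl
    exact hno s hs t ⟨htB, fun h => ht ⟨t, h, rfl⟩⟩ (addVertexOnEdge_adj_castSucc.1 hst)

theorem touches_preimage_castSucc {n : ℕ} {G : SimpleGraph (Fin n)} {a b : Fin n}
    (hab : G.Adj a b) {A B : Set (Fin (n + 1))} (hA : CutConnected (addVertexOnEdge G a b) A)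
    (hAne : (Fin.castSucc ⁻¹' A).Nonempty) (hAB : Disjoint A B) {t : Fin (n + 1)} (ht : t ∈ B)
    (hl : Fin.last n ∈ A) (hlt : (addVertexOnEdge G a b).Adj (Fin.last n) t) :
    Touches G (Fin.castSucc ⁻¹' A) (Fin.castSucc ⁻¹' B) := by
  obtain ⟨x, hx⟩ := hAne
  obtain ⟨s, rfl, r, hr, hsr⟩ := hA {Fin.last n} (by simpa using hl) ⟨_, rfl⟩
    ⟨x.castSucc, hx, (Fin.castSucc_lt_last x).ne⟩
  have hrt : r ≠ t := fun h => Set.disjoint_left.1 hAB hr.1 (h ▸ ht)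
  rcases addVertexOnEdge_adj_last hlt with rfl | rfl <;>
    rcases addVertexOnEdge_adj_last hsr with rfl | rfl
  exacts [absurd rfl hrt, ⟨b, hr.1, a, ht, hab.symm⟩, ⟨a, hr.1, b, ht, hab⟩, absurd rfl hrt]

theorem IsK4Model.preimage_castSucc {n : ℕ} {G : SimpleGraph (Fin n)} {a b : Fin n}
    (hab : G.Adj a b) {B : Fin 4 → Set (Fin (n + 1))}
    (hB : IsK4Model (addVertexOnEdge G a b) B) :
    IsK4Model G fun i => Fin.castSucc ⁻¹' B i := by
  have hne : ∀ i, (Fin.castSucc ⁻¹' B i).Nonempty := by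
    intro i
    by_contra hemp
    have hlast : ∀ s ∈ B i, s = Fin.last n := by
      intro s hs
      by_contra hsl
      obtain ⟨s, rfl⟩ := Fin.exists_castSucc_eq.2 hsl
      exact hemp ⟨s, hs⟩
    have hmem : ∀ j, i ≠ j → a.castSucc ∈ B j ∨ b.castSucc ∈ B j := by
      intro j hij
      obtain ⟨s, hs, t, ht, hst⟩ := hB.touches i j hij
      obtain rfl := hlast s hs
      rcases addVertexOnEdge_adj_last hst with rfl | rfl
      exacts [Or.inl ht, Or.inr ht]
    have hone : ∀ j k, j ≠ k → ∀ t, t ∈ B j → t ∉ B k := fun j k hjk t =>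
      fun h => Set.disjoint_left.1 (hB.disjoint j k hjk) h
    obtain ⟨j, k, l, hj, hk, hl, hjk, hjl, hkl⟩ : ∃ j k l : Fin 4,
        i ≠ j ∧ i ≠ k ∧ i ≠ l ∧ j ≠ k ∧ j ≠ l ∧ k ≠ l := by
      clear hemp hlast hmem
      revert i; decide
    have h1 := hmem j hj
    have h2 := hmem k hk
    have h3 := hmem l hl
    have := hone j k hjk
    have := hone j l hjl
    have := hone k l hkl
    grind
  refine ⟨hne, fun i => (hB.conn i).preimage_castSucc hab,
    fun i j hij => (hB.disjoint i j hij).preimage _, fun i j hij => ?_⟩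
  obtain ⟨s, hs, t, ht, hst⟩ := hB.touches i j hij
  by_cases hsl : s = Fin.last n
  · subst hsl
    exact touches_preimage_castSucc hab (hB.conn i) (hne i) (hB.disjoint i j hij) ht hs hst
  by_cases htl : t = Fin.last n
  · subst htl
    exact (touches_preimage_castSucc hab (hB.conn j) (hne j) (hB.disjoint j i hij.symm) hs ht
      hst.symm).symm
  obtain ⟨s, rfl⟩ := Fin.exists_castSucc_eq.2 hsl
  obtain ⟨t, rfl⟩ := Fin.exists_castSucc_eq.2 htl
  exact ⟨s, hs, t, ht, addVertexOnEdge_adj_castSucc.1 hst⟩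

theorem IsTwoTree.not_isK4Model {n : ℕ} {T : SimpleGraph (Fin n)} (hT : IsTwoTree T) :
    ∀ B, ¬ IsK4Model T B := by
  induction hT with
  | base =>
    intro B hB
    choose g hg using hB.nonempty
    have hinj : Function.Injective g := by
      intro i j hij
      by_contra hne
      exact Set.disjoint_left.1 (hB.disjoint i j hne) (hg i) (hij ▸ hg j)
    simpa using Fintype.card_le_of_injective g hinj
  | extend G a b _ hab ih => exact fun B hB => ih _ (hB.preimage_castSucc hab)

theorem IsPartialTwoTree.not_isK4Model {G : SimpleGraph V} (hG : IsPartialTwoTree G)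
    (B : Fin 4 → Set V) : ¬ IsK4Model G B := by
  obtain ⟨n, T, f, hT, hf⟩ := hG
  exact fun hB => hT.not_isK4Model _ (hB.image f hf)

theorem isK4Model_of_sets {G : SimpleGraph V} {A B C D : Set V}
    (hA : A.Nonempty) (hB : B.Nonempty) (hC : C.Nonempty) (hD : D.Nonempty)
    (cA : CutConnected G A) (cB : CutConnected G B) (cC : CutConnected G C)
    (cD : CutConnected G D)
    (dAB : Disjoint A B) (dAC : Disjoint A C) (dAD : Disjoint A D)
    (dBC : Disjoint B C) (dBD : Disjoint B D) (dCD : Disjoint C D)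
    (tAB : Touches G A B) (tAC : Touches G A C) (tAD : Touches G A D)
    (tBC : Touches G B C) (tBD : Touches G B D) (tCD : Touches G C D) :
    IsK4Model G ![A, B, C, D] where
  nonempty i := by fin_cases i <;> assumption
  conn i := by fin_cases i <;> assumption
  disjoint i j hij := by
    fin_cases i <;> fin_cases j <;>
      first | exact absurd rfl hij | assumption | (apply Disjoint.symm; assumption)
  touches i j hij := by
    fin_cases i <;> fin_cases j <;>
      first | exact absurd rfl hij | assumption | (apply Touches.symm; assumption)

/-! ### Paths -/

theorem walkInterior_reverse {G : SimpleGraph V} {a b : V} (p : G.Walk a b) :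
    walkInterior p.reverse = walkInterior p := by
  simp [walkInterior, Set.pair_comm]

/-- A path without its last vertex is connected, and touches the last vertex. -/
theorem cutConnected_insert_walkInterior {G : SimpleGraph V} {a b : V} (p : G.Walk a b)
    (hp : p.IsPath) (hab : a ≠ b) :
    CutConnected G (insert a (walkInterior p)) ∧
      Touches G (insert a (walkInterior p)) {b} := by
  induction p with
  | nil => exact absurd rfl hab
  | @cons a c b h q ih =>
    rw [SimpleGraph.Walk.cons_isPath_iff] at hp
    by_cases hcb : c = b
    · subst hcb
      obtain rfl := (SimpleGraph.Walk.isPath_iff_nil.1 hp.1).eq_nil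
      have : insert a (walkInterior (SimpleGraph.Walk.cons h SimpleGraph.Walk.nil)) = {a} := by
        ext t; simp [walkInterior]; tauto
      rw [this]
      exact ⟨cutConnected_singleton G a, a, rfl, c, rfl, h⟩
    · obtain ⟨hc, ht⟩ := ih hp.1 hcb
      have hset : insert a (walkInterior (SimpleGraph.Walk.cons h q)) =
          {a} ∪ insert c (walkInterior q) := by
        ext t
        have hcq : c ∈ q.support := q.start_mem_support
        simp only [walkInterior, SimpleGraph.Walk.support_cons, List.mem_cons, Set.mem_insert_iff,
          Set.mem_sdiff, Set.mem_ofPred_eq, Set.mem_singleton_iff, Set.mem_union]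
        grind
      rw [hset]
      exact ⟨(cutConnected_singleton G a).union_of_touches hc
          ⟨a, rfl, c, Set.mem_insert _ _, h⟩,
        ht.mono Set.subset_union_right subset_rfl⟩

theorem IsPartialTwoTree.not_hasK4Subdivision {G : SimpleGraph V} (hG : IsPartialTwoTree G) :
    ¬ HasK4Subdivision G := by
  rintro ⟨a, b, c, d, ⟨K⟩⟩
  have hnd := K.branch_nodup
  have hdis := K.interiors_disjoint
  have hav := K.interiors_avoid_branch
  simp only [List.pairwise_cons, List.mem_cons, List.not_mem_nil, or_false, forall_eq_or_imp,
    forall_eq, IsEmpty.forall_iff, implies_true, List.Pairwise.nil, and_true] at hnd hdis hav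
  obtain ⟨⟨ab, ac, ad⟩, ⟨bc, bd⟩, cd⟩ := hnd
  obtain ⟨cab, tab⟩ := cutConnected_insert_walkInterior _ K.isPath_pab ab
  obtain ⟨cac, tac⟩ := cutConnected_insert_walkInterior _ K.isPath_pac ac
  obtain ⟨cad, tad⟩ := cutConnected_insert_walkInterior _ K.isPath_pad ad
  obtain ⟨cbc, tbc⟩ := cutConnected_insert_walkInterior _ K.isPath_pbc bc
  obtain ⟨cbd, tbd⟩ := cutConnected_insert_walkInterior _ K.isPath_pbd bd
  obtain ⟨ccd, tcd⟩ := cutConnected_insert_walkInterior _ K.isPath_pcd cd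
  generalize walkInterior K.pab = Iab at *
  generalize walkInterior K.pac = Iac at *
  generalize walkInterior K.pad = Iad at *
  generalize walkInterior K.pbc = Ibc at *
  generalize walkInterior K.pbd = Ibd at *
  generalize walkInterior K.pcd = Icd at *
  simp only [Set.mem_insert_iff, Set.mem_singleton_iff, not_or, Set.disjoint_left] at hdis hav
  refine hG.not_isK4Model _ (isK4Model_of_sets (A := insert a Iab ∪ insert a Iac ∪ insert a Iad)
    (B := insert b Ibc ∪ insert b Ibd) (C := insert c Icd) (D := {d})
    ⟨a, by simp⟩ ⟨b, by simp⟩ ⟨c, by simp⟩ ⟨d, rfl⟩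
    ((cab.union_of_mem cac (x := a) (by simp) (by simp)).union_of_mem cad (x := a)
      (by simp) (by simp))
    (cbc.union_of_mem cbd (x := b) (by simp) (by simp)) ccd (cutConnected_singleton G d)
    ?_ ?_ ?_ ?_ ?_ ?_
    (tab.mono ?_ ?_) (tac.mono ?_ ?_) (tad.mono ?_ ?_) (tbc.mono ?_ ?_) (tbd.mono ?_ ?_) tcd)
  all_goals
    first
    | (rw [Set.disjoint_left]; intro t; simp only [Set.mem_union, Set.mem_insert_iff,
        Set.mem_singleton_iff]; grind)
    | (intro t; simp only [Set.mem_union, Set.mem_insert_iff, Set.mem_singleton_iff]; tauto)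

/-! ### Separating the three arms -/

/-- Without a `K₄`-minor, disjoint connected sets `A`, `B`, `C`, each touching `u` and `v`,
lie in different components of `G - {u, v}`. -/
theorem not_reachable_of_arms {G : SimpleGraph V} (hG : ∀ D, ¬ IsK4Model G D) {u v x y : V}
    (huv : u ≠ v) {A B C : Set V} (hxA : x ∈ A) (hyB : y ∈ B) (hC : C.Nonempty)
    (cA : CutConnected G A) (cB : CutConnected G B) (cC : CutConnected G C)
    (dAB : Disjoint A B) (dAC : Disjoint A C) (dBC : Disjoint B C)
    (huA : u ∉ A) (huB : u ∉ B) (huC : u ∉ C) (hvA : v ∉ A) (hvB : v ∉ B) (hvC : v ∉ C)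
    (tAu : Touches G A {u}) (tBu : Touches G B {u}) (tCu : Touches G C {u})
    (tAv : Touches G A {v}) (tBv : Touches G B {v}) (tCv : Touches G C {v})
    (hx : x ∈ {t | t ≠ u ∧ t ≠ v}) (hy : y ∈ {t | t ≠ u ∧ t ≠ v}) :
    ¬ (G.induce {t | t ≠ u ∧ t ≠ v}).Reachable ⟨x, hx⟩ ⟨y, hy⟩ := by
  let F : Set V := {t | t ≠ u ∧ t ≠ v ∧ t ∉ B ∧ t ∉ C}
  let M : Set V := {t | Relation.ReflTransGen (fun s r => G.Adj s r ∧ r ∈ F) x t}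
  have hAF : A ⊆ F := fun t ht => ⟨fun h => huA (h ▸ ht), fun h => hvA (h ▸ ht),
    Set.disjoint_left.1 dAB ht, Set.disjoint_left.1 dAC ht⟩
  have hxM : x ∈ M := Relation.ReflTransGen.refl
  have hMF : M ⊆ F := by
    intro t ht
    rcases Relation.ReflTransGen.cases_tail ht with rfl | ⟨s, -, h⟩
    exacts [hAF hxA, h.2]
  have hstep : ∀ s ∈ M, ∀ r ∈ F, G.Adj s r → r ∈ M := fun s hs r hr hsr => hs.tail ⟨hsr, hr⟩
  have hAM : A ⊆ M := cA.subset_of_closed hxA hxM fun s hs r hr => hstep s hs r (hAF hr)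
  have cM : CutConnected G M := by
    intro S hS hSne hSc
    by_contra hno
    push Not at hno
    have aux : ∀ t ∈ M, (t ∈ S ↔ x ∈ S) := by
      intro t ht
      induction ht with
      | refl => rfl
      | @tail s r hs hr ih =>
        have hrM := hstep s hs r hr.2 hr.1
        rw [← ih]
        refine ⟨fun h => ?_, fun h => ?_⟩
        · by_contra hsS
          exact hno r h s ⟨hs, hsS⟩ hr.1.symm
        · by_contra hrS
          exact hno s h r ⟨hrM, hrS⟩ hr.1
    obtain ⟨s, hs⟩ := hSne
    obtain ⟨r, hr, hrS⟩ := hSc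
    exact hrS ((aux r hr).2 ((aux s (hS hs)).1 hs))
  have dMB : Disjoint M B := Set.disjoint_left.2 fun t ht => (hMF ht).2.2.1
  have dMC : Disjoint M C := Set.disjoint_left.2 fun t ht => (hMF ht).2.2.2
  have huM : u ∉ M := fun h => (hMF h).1 rfl
  have hvM : v ∉ M := fun h => (hMF h).2.1 rfl
  have tMu : Touches G M {u} := tAu.mono hAM subset_rfl
  have tMv : Touches G M {v} := tAv.mono hAM subset_rfl
  have notouch : ∀ {P Q : Set V}, P.Nonempty → Q.Nonempty → CutConnected G P → CutConnected G Q →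
      Disjoint M P → Disjoint M Q → Disjoint P Q → u ∉ P → v ∉ P → v ∉ Q →
      Touches G P {u} → Touches G Q {u} → Touches G P {v} → Touches G Q {v} →
      ¬ Touches G M P := by
    intro P Q hP hQ cP cQ dMP dMQ dPQ huP hvP hvQ tPu tQu tPv tQv h
    refine hG _ (isK4Model_of_sets (A := M) (B := P) (C := Q ∪ {u}) (D := {v})
      ⟨x, hxM⟩ hP ⟨u, by simp⟩ ⟨v, rfl⟩ cM cP
      (cQ.union_of_touches (cutConnected_singleton G u) tQu) (cutConnected_singleton G v)
      dMP (by simp [dMQ, huM]) (by simp [hvM]) (by simp [dPQ, huP]) (by simp [hvP])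
      (by simp [hvQ, huv.symm]) h (tMu.mono subset_rfl (by simp)) tMv
      (tPu.mono subset_rfl (by simp)) tPv (tQv.mono (by simp) subset_rfl))
  have hMB : ¬ Touches G M B := notouch ⟨y, hyB⟩ hC cB cC dMB dMC dBC huB hvB hvC tBu tCu tBv tCv
  have hMC : ¬ Touches G M C :=
    notouch hC ⟨y, hyB⟩ cC cB dMC dMB dBC.symm huC hvC hvB tCu tBu tCv tBv
  have hclosed : ∀ s t : {t | t ≠ u ∧ t ≠ v}, (G.induce {t | t ≠ u ∧ t ≠ v}).Walk s t →
      (s : V) ∈ M → (t : V) ∈ M := by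
    intro s t p
    induction p with
    | nil => exact id
    | @cons s r t h q ih =>
      intro hs
      have hsr : G.Adj s r := h
      exact ih (hstep s hs r ⟨r.2.1, r.2.2, fun hr => hMB ⟨s, hs, r, hr, hsr⟩,
        fun hr => hMC ⟨s, hs, r, hr, hsr⟩⟩ hsr)
  rintro ⟨p⟩
  exact Set.disjoint_left.1 dMB (hclosed _ _ p hxM) hyB

/-- The two paths of a `K_{2,3}`-subdivision through a branch vertex `x` of the larger side,
without `u` and `v`, form a connected set touching `u` and `v`. -/
theorem arm_properties {G : SimpleGraph V} {u v x : V} (p : G.Walk u x) (q : G.Walk v x)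
    (hp : p.IsPath) (hq : q.IsPath) (hux : u ≠ x) (hvx : v ≠ x) :
    CutConnected G (insert x (walkInterior p ∪ walkInterior q)) ∧
      Touches G (insert x (walkInterior p ∪ walkInterior q)) {u} ∧
      Touches G (insert x (walkInterior p ∪ walkInterior q)) {v} := by
  obtain ⟨c₁, t₁⟩ := cutConnected_insert_walkInterior p.reverse hp.reverse hux.symm
  obtain ⟨c₂, t₂⟩ := cutConnected_insert_walkInterior q.reverse hq.reverse hvx.symm
  rw [walkInterior_reverse] at c₁ t₁ c₂ t₂
  rw [Set.insert_union_distrib]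
  exact ⟨c₁.union_of_mem c₂ (x := x) (by simp) (by simp),
    t₁.mono Set.subset_union_left subset_rfl, t₂.mono Set.subset_union_right subset_rfl⟩

/-- In a graph without `K₄`-minor, the three branch vertices on the larger side of a
`K_{2,3}`-subdivision lie in different components of `G - {u, v}`. -/
theorem K23Subdiv.three_le_numComponentsDel [Finite V] {G : SimpleGraph V}
    (hG : ∀ D, ¬ IsK4Model G D) {u v x y z : V} (K : K23Subdiv G u v x y z) :
    3 ≤ numComponentsDel G u v := by
  have hnd := K.branch_nodup
  have hdis := K.interiors_disjoint
  have hav := K.interiors_avoid_branch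
  simp only [List.pairwise_cons, List.mem_cons, List.not_mem_nil, or_false, forall_eq_or_imp,
    forall_eq, IsEmpty.forall_iff, implies_true, List.Pairwise.nil, and_true] at hnd hdis hav
  obtain ⟨⟨uv, ux, uy, uz⟩, ⟨vx, vy, vz⟩, ⟨xy, xz⟩, yz⟩ := hnd
  obtain ⟨cX, tXu, tXv⟩ := arm_properties _ _ K.isPath_pux K.isPath_pvx ux vx
  obtain ⟨cY, tYu, tYv⟩ := arm_properties _ _ K.isPath_puy K.isPath_pvy uy vy
  obtain ⟨cZ, tZu, tZv⟩ := arm_properties _ _ K.isPath_puz K.isPath_pvz uz vz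
  generalize walkInterior K.pux = Iux at *
  generalize walkInterior K.puy = Iuy at *
  generalize walkInterior K.puz = Iuz at *
  generalize walkInterior K.pvx = Ivx at *
  generalize walkInterior K.pvy = Ivy at *
  generalize walkInterior K.pvz = Ivz at *
  simp only [Set.mem_insert_iff, Set.mem_singleton_iff, not_or, Set.disjoint_left] at hdis hav
  have dXY : Disjoint (insert x (Iux ∪ Ivx)) (insert y (Iuy ∪ Ivy)) := by
    rw [Set.disjoint_left]; intro t; simp only [Set.mem_union, Set.mem_insert_iff]; grind
  have dXZ : Disjoint (insert x (Iux ∪ Ivx)) (insert z (Iuz ∪ Ivz)) := by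
    rw [Set.disjoint_left]; intro t; simp only [Set.mem_union, Set.mem_insert_iff]; grind
  have dYZ : Disjoint (insert y (Iuy ∪ Ivy)) (insert z (Iuz ∪ Ivz)) := by
    rw [Set.disjoint_left]; intro t; simp only [Set.mem_union, Set.mem_insert_iff]; grind
  have huX : u ∉ insert x (Iux ∪ Ivx) := by simp only [Set.mem_union, Set.mem_insert_iff]; grind
  have huY : u ∉ insert y (Iuy ∪ Ivy) := by simp only [Set.mem_union, Set.mem_insert_iff]; grind
  have huZ : u ∉ insert z (Iuz ∪ Ivz) := by simp only [Set.mem_union, Set.mem_insert_iff]; grind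
  have hvX : v ∉ insert x (Iux ∪ Ivx) := by simp only [Set.mem_union, Set.mem_insert_iff]; grind
  have hvY : v ∉ insert y (Iuy ∪ Ivy) := by simp only [Set.mem_union, Set.mem_insert_iff]; grind
  have hvZ : v ∉ insert z (Iuz ∪ Ivz) := by simp only [Set.mem_union, Set.mem_insert_iff]; grind
  have hx := Set.mem_insert x (Iux ∪ Ivx)
  have hy := Set.mem_insert y (Iuy ∪ Ivy)
  have hz := Set.mem_insert z (Iuz ∪ Ivz)
  have mx : x ∈ {t | t ≠ u ∧ t ≠ v} := ⟨ux.symm, vx.symm⟩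
  have my : y ∈ {t | t ≠ u ∧ t ≠ v} := ⟨uy.symm, vy.symm⟩
  have mz : z ∈ {t | t ≠ u ∧ t ≠ v} := ⟨uz.symm, vz.symm⟩
  have nxy := not_reachable_of_arms hG uv hx hy ⟨z, hz⟩ cX cY cZ dXY dXZ dYZ huX huY huZ
    hvX hvY hvZ tXu tYu tZu tXv tYv tZv mx my
  have nxz := not_reachable_of_arms hG uv hx hz ⟨y, hy⟩ cX cZ cY dXZ dXY dYZ.symm huX huZ huY
    hvX hvZ hvY tXu tZu tYu tXv tZv tYv mx mz
  have nyz := not_reachable_of_arms hG uv hy hz ⟨x, hx⟩ cY cZ cX dYZ dXY.symm dXZ.symm huY huZ huX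
    hvY hvZ hvX tYu tZu tXu tYv tZv tXv my mz
  rw [← SimpleGraph.ConnectedComponent.eq] at nxy nxz nyz
  have : Finite (G.induce {t | t ≠ u ∧ t ≠ v}).ConnectedComponent := Quot.finite _
  rw [numComponentsDel, ← Set.ncard_univ,
    ← Set.ncard_eq_three.2 ⟨_, _, _, nxy, nxz, nyz, rfl⟩]
  exact Set.ncard_le_ncard (Set.subset_univ _)

variable [Fintype V] [LinearOrder V]

theorem exists_k23Subdivision_three_components
    (G : SimpleGraph V) (h2t : IsPartialTwoTree G) (hout : ¬ IsOuterplanar G) :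
    ∃ u v x y z : V, Nonempty (K23Subdiv G u v x y z) ∧ 3 ≤ numComponentsDel G u v := by
  have hK23 : HasK23Subdivision G := by
    by_contra h
    exact hout ⟨h2t.not_hasK4Subdivision, h⟩
  obtain ⟨u, v, x, y, z, ⟨K⟩⟩ := hK23
  exact ⟨u, v, x, y, z, ⟨K⟩, K.three_le_numComponentsDel h2t.not_isK4Model⟩

end LexMCB
end

section
/- Let G be a weighted graph with a total order on its vertices. The intersection of any two lex shortest paths of G (the subgraph whose vertex set is the intersection of their vertex sets and whose edge set is the intersection of their edge sets) is either empty or is itself a lex shortest path between its endpoints. -/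
/-!
Common definitions for formalizing "Minimum Cycle Basis in Weighted Partial 2-trees".
-/

namespace LexMCB

open SimpleGraph

variable {V : Type*}

/-! ### Restriction and uniqueness of lex shortest paths -/

section LexShortestPath

variable {G : SimpleGraph V} {w : Sym2 V → ℕ} {a b c : V}

lemma walkWeight_append (p : G.Walk a b) (q : G.Walk b c) :
    walkWeight w (p.append q) = walkWeight w p + walkWeight w q := by
  simp [walkWeight]

lemma walkWeight_reverse (p : G.Walk a b) : walkWeight w p.reverse = walkWeight w p := by
  simp [walkWeight, List.sum_reverse]

lemma walkWeight_bypass_le [DecidableEq V] (p : G.Walk a b) :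
    walkWeight w p.bypass ≤ walkWeight w p :=
  (p.edges_bypass_sublist_edges.map w).sum_le_sum (by simp)

/-- A walk splits at its first vertex satisfying a given predicate. -/
lemma exists_append_first {S : V → Prop} (p : G.Walk a b) (h : ∃ t ∈ p.support, S t) :
    ∃ (x : V) (p₁ : G.Walk a x) (p₂ : G.Walk x b),
      p = p₁.append p₂ ∧ S x ∧ ∀ t ∈ p₁.support, S t → t = x := by
  induction p with
  | nil =>
    obtain ⟨t, ht, hS⟩ := h
    obtain rfl := by simpa using ht
    exact ⟨_, .nil, .nil, rfl, hS, by simp⟩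
  | @cons u v z huv p ih =>
    by_cases hu : S u
    · exact ⟨u, .nil, .cons huv p, rfl, hu, by simp⟩
    · obtain ⟨t, ht, hS⟩ := h
      rw [Walk.support_cons, List.mem_cons] at ht
      obtain ⟨x, p₁, p₂, rfl, hx, hp₁⟩ :=
        ih ⟨t, ht.resolve_left (by rintro rfl; exact hu hS), hS⟩
      refine ⟨x, .cons huv p₁, p₂, rfl, hx, fun t ht hS => ?_⟩
      rw [Walk.support_cons, List.mem_cons] at ht
      exact hp₁ t (ht.resolve_left (by rintro rfl; exact hu hS)) hS

lemma eq_of_mem_support_of_isPath_append {p : G.Walk a b} {q : G.Walk b c}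
    (h : (p.append q).IsPath) {t : V} (hp : t ∈ p.support) (hq : t ∈ q.support) : t = b := by
  by_contra hne
  exact h.ne_of_mem_support_of_append hne hp hq rfl

variable [LinearOrder V]

lemma isLexShortestPath_iff {p : G.Walk a b} :
    IsLexShortestPath w p ↔ p.IsPath ∧ ∀ q : G.Walk a b, q.IsPath → q ≠ p → LexBetter w p q := by
  have h (q : G.Walk a b) : WalkIn Set.univ G.edgeSet q :=
    ⟨fun _ _ => trivial, fun _ he => q.edges_subset_edgeSet he⟩
  simp [IsLexShortestPath, IsLexShortestPathIn, h]

lemma LexBetter.asymm {p q : G.Walk a b} (h : LexBetter w p q) : ¬ LexBetter w q p := by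
  rintro (h' | ⟨h₁, h₂⟩ | ⟨h₁, h₂, h₃⟩) <;> rcases h with k | ⟨k₁, k₂⟩ | ⟨k₁, k₂, k₃⟩
  all_goals first | omega | exact lt_asymm h₃ k₃

lemma LexBetter.reverse {p q : G.Walk a b} (h : LexBetter w p q) :
    LexBetter w p.reverse q.reverse := by
  simpa [LexBetter, walkWeight_reverse] using h

lemma IsLexShortestPath.reverse {p : G.Walk a b} (h : IsLexShortestPath w p) :
    IsLexShortestPath w p.reverse := by
  rw [isLexShortestPath_iff] at h ⊢
  refine ⟨h.1.reverse, fun q hq hne => ?_⟩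
  have := (h.2 q.reverse hq.reverse (by rintro rfl; simp at hne)).reverse
  rwa [Walk.reverse_reverse] at this

lemma IsLexShortestPath.eq {p q : G.Walk a b} (hp : IsLexShortestPath w p)
    (hq : IsLexShortestPath w q) : p = q := by
  rw [isLexShortestPath_iff] at hp hq
  by_contra hne
  exact (hp.2 q hq.1 (Ne.symm hne)).asymm (hq.2 p hp.1 hne)

lemma IsLexShortestPath.of_append_left {p : G.Walk a b} {q : G.Walk b c}
    (h : IsLexShortestPath w (p.append q)) : IsLexShortestPath w p := by
  rw [isLexShortestPath_iff] at h ⊢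
  obtain ⟨hpath, hbest⟩ := h
  refine ⟨hpath.of_append_left, fun p' hp' hne => ?_⟩
  have hweight := walkWeight_bypass_le (w := w) (p'.append q)
  have hw := walkWeight_append (w := w) p q
  have hw' := walkWeight_append (w := w) p' q
  have hl := p.length_append q
  have hl' := p'.length_append q
  by_cases hlen : (p'.append q).length ≤ (p'.append q).bypass.length
  · have hpath' : (p'.append q).IsPath := by
      rw [← Walk.bypass_eq_self_of_length_le_length_bypass _ hlen]
      exact Walk.bypass_isPath _
    have hsdiff {r s : G.Walk a b} (hr : (r.append q).IsPath) :
        (r.append q).support.toFinset \ (s.append q).support.toFinset =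
          r.support.toFinset \ s.support.toFinset := by
      ext t
      simp only [Finset.mem_sdiff, List.mem_toFinset, Walk.mem_support_append_iff]
      have hb : t ∈ r.support → t ∈ q.support → t ∈ s.support := fun h₁ h₂ =>
        eq_of_mem_support_of_isPath_append hr h₁ h₂ ▸ s.end_mem_support
      tauto
    have hne' : p'.append q ≠ p.append q := fun heq => hne <| by
      have := congrArg Walk.support heq
      rw [Walk.support_append, Walk.support_append] at this
      exact Walk.ext_support (List.append_cancel_right this)
    have := hbest _ hpath' hne'
    rw [LexBetter, hsdiff hpath, hsdiff hpath'] at this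
    unfold LexBetter
    rcases this with h | ⟨h₁, h₂⟩ | ⟨h₁, h₂, h₃⟩
    · left; omega
    · right; left; omega
    · right; right; exact ⟨by omega, by omega, h₃⟩
  · unfold LexBetter
    by_cases heq : (p'.append q).bypass = p.append q
    · rw [heq] at hweight hlen
      omega
    · rcases hbest _ (Walk.bypass_isPath _) heq with h | ⟨h₁, h₂⟩ | ⟨h₁, h₂, -⟩ <;> omega

lemma IsLexShortestPath.of_append_right {p : G.Walk a b} {q : G.Walk b c}
    (h : IsLexShortestPath w (p.append q)) : IsLexShortestPath w q := by
  have h' := h.reverse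
  rw [Walk.reverse_append] at h'
  simpa using h'.of_append_left.reverse

/-- A lex shortest path contains the lex shortest path between any two of its vertices. -/
lemma IsLexShortestPath.subset_of_mem_support {c d x y : V} {q : G.Walk c d} {r : G.Walk x y}
    (hq : IsLexShortestPath w q) (hr : IsLexShortestPath w r)
    (hx : x ∈ q.support) (hy : y ∈ q.support) :
    r.support ⊆ q.support ∧ r.edges ⊆ q.edges := by
  obtain ⟨q₁, q₂, rfl⟩ := Walk.mem_support_iff_exists_append.mp hx
  rcases (Walk.mem_support_append_iff _ _).mp hy with hy | hy
  · obtain ⟨q₃, s, rfl⟩ := Walk.mem_support_iff_exists_append.mp hy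
    have := hr.eq hq.of_append_left.of_append_right.reverse
    subst this
    constructor <;> intro t ht <;> simp_all [Walk.mem_support_append_iff]
  · obtain ⟨s, q₃, rfl⟩ := Walk.mem_support_iff_exists_append.mp hy
    have := hr.eq hq.of_append_right.of_append_left
    subst this
    constructor <;> intro t ht <;> simp_all [Walk.mem_support_append_iff]

end LexShortestPath

variable [Fintype V] [LinearOrder V]

theorem lsp_inter_lsp
    (G : SimpleGraph V) (w : Sym2 V → ℕ)
    {a b c d : V} (p : G.Walk a b) (q : G.Walk c d)
    (hp : IsLexShortestPath w p) (hq : IsLexShortestPath w q) :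
    ({t | t ∈ p.support} ∩ {t | t ∈ q.support} = (∅ : Set V) ∧
      {e | e ∈ p.edges} ∩ {e | e ∈ q.edges} = (∅ : Set (Sym2 V))) ∨
    ∃ (x y : V) (r : G.Walk x y), IsLexShortestPath w r ∧
      {t | t ∈ r.support} = {t | t ∈ p.support} ∩ {t | t ∈ q.support} ∧
      {e | e ∈ r.edges} = {e | e ∈ p.edges} ∩ {e | e ∈ q.edges} := by
  by_cases hne : ∃ t ∈ p.support, t ∈ q.support
  · right
    obtain ⟨x, p₁, p', rfl, hx, hp₁⟩ := exists_append_first p hne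
    obtain ⟨y, p₂, r, hr, hy, hp₂⟩ :=
      exists_append_first (S := (· ∈ q.support)) p'.reverse ⟨x, by simp, hx⟩
    obtain rfl : p' = r.reverse.append p₂.reverse := by
      rw [← Walk.reverse_append, ← hr, Walk.reverse_reverse]
    have hlsp := hp.of_append_right.of_append_left
    obtain ⟨hsupp, hedge⟩ := hq.subset_of_mem_support hlsp hx hy
    have not_mem_edges {u v : V} {s : G.Walk u v} {z : V}
        (hs : ∀ t ∈ s.support, t ∈ q.support → t = z) {e : Sym2 V} (he : e ∈ q.edges) :
        e ∉ s.edges := by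
      induction e with | _ t t' =>
      intro hes
      refine (s.adj_of_mem_edges hes).ne ?_
      rw [hs t (s.fst_mem_support_of_mem_edges hes) (q.fst_mem_support_of_mem_edges he),
        hs t' (s.snd_mem_support_of_mem_edges hes) (q.snd_mem_support_of_mem_edges he)]
    refine ⟨x, y, r.reverse, hlsp, ?_, ?_⟩
    · ext t
      refine ⟨fun ht => ⟨by simp_all [Walk.mem_support_append_iff], hsupp ht⟩, ?_⟩
      rintro ⟨ht, htq⟩
      simp only [Set.mem_ofPred_eq, Walk.mem_support_append_iff] at ht ⊢
      rcases ht with ht | ht | ht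
      · rw [hp₁ t ht htq]
        exact Walk.start_mem_support _
      · exact ht
      · rw [hp₂ t (by simpa using ht) htq]
        exact Walk.end_mem_support _
    · ext e
      refine ⟨fun he => ⟨by simp_all, hedge he⟩, ?_⟩
      rintro ⟨he, heq⟩
      simp only [Set.mem_ofPred_eq, Walk.edges_append, List.mem_append] at he ⊢
      rcases he with he | he | he
      · exact (not_mem_edges hp₁ heq he).elim
      · exact he
      · exact (not_mem_edges hp₂ heq (by simpa using he)).elim
  · left
    constructor
    · ext t
      simpa using fun h h' => hne ⟨t, h, h'⟩
    · ext e
      induction e with | _ t t' =>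
      simpa using fun h h' => hne
        ⟨t, p.fst_mem_support_of_mem_edges h, q.fst_mem_support_of_mem_edges h'⟩

end LexMCB
end

section
/- Let G be a connected weighted partial 2-tree that is not outerplanar, let {u,v} be a vertex separator of G such that G − {u,v} has at least three components, let H be a component of G − {u,v} with V(lsp(u,v)) ∩ V(H) = ∅ and E(lsp(u,v)) ∩ E(H) = ∅, and let G₁, G₂ be obtained by decomp(G,u,v). Then for each i ∈ {1,2}, every vertex x ∈ V(G_i), and every vertex y ∈ V(G_i) ∖ V(lsp(u,v)), every x–y path P in G whose internal vertices all lie in V(G_i) ∖ {u,v} is contained in G_i. -/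
/-!
Common definitions for formalizing "Minimum Cycle Basis in Weighted Partial 2-trees".
-/

namespace LexMCB

open SimpleGraph

variable {V : Type*}

/-- A connected set of vertices of `A` that meets a component of `G[A]` lies in it. -/
lemma IsComponentOf.subset_of_connected {G : SimpleGraph V} {A H K : Set V}
    (hH : IsComponentOf G A H) (hKA : K ⊆ A) (hK : (G.induce K).Connected)
    (hne : (H ∩ K).Nonempty) : K ⊆ H := by
  obtain ⟨-, hHA, hHconn, hmax⟩ := hH
  rw [← hmax (H ∪ K) Set.subset_union_left (Set.union_subset hHA hKA)
    (induce_union_connected hHconn.preconnected hK.preconnected hne)]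
  exact Set.subset_union_right

/-- A walk in `G[A]` that ends in a component of `G[A]` lies in that component. -/
lemma IsComponentOf.support_subset {G : SimpleGraph V} {A H : Set V}
    (hH : IsComponentOf G A H) {x y : V} (p : G.Walk x y) (hy : y ∈ H)
    (hp : ∀ t ∈ p.support, t ∈ A) : ∀ t ∈ p.support, t ∈ H :=
  hH.subset_of_connected hp p.connected_induce_support ⟨y, hy, p.end_mem_support⟩

/-- A vertex of `A` adjacent to a component of `G[A]` lies in that component. -/
lemma IsComponentOf.mem_of_adj {G : SimpleGraph V} {A H : Set V}
    (hH : IsComponentOf G A H) {a b : V} (hab : G.Adj a b) (ha : a ∈ A) (hb : b ∈ H) :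
    a ∈ H :=
  hH.support_subset hab.toWalk hb (by simp [ha, hH.2.1 hb]) a (by simp)

/-- Every edge of a walk inside `H` lies within `H`. -/
lemma edges_subset_edgesWithin {G : SimpleGraph V} {H : Set V} {x y : V} (p : G.Walk x y)
    (hp : ∀ t ∈ p.support, t ∈ H) : ∀ e ∈ p.edges, e ∈ edgesWithin G H :=
  fun _ he => ⟨p.edges_subset_edgeSet he, fun _ ht => hp _ (p.mem_support_of_mem_edges he ht)⟩

variable [Fintype V] [LinearOrder V]

theorem decomp_path_internal_vertices
    (G : SimpleGraph V) (w : Sym2 V → ℕ)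
    (hconn : G.Connected) (h2t : IsPartialTwoTree G) (hout : ¬ IsOuterplanar G)
    (u v : V) (huv : u ≠ v) (hsep : IsSeparatorPair G u v)
    (hcomp3 : 3 ≤ numComponentsDel G u v)
    (P : G.Walk u v) (hP : IsLexShortestPath w P)
    (H : Set V) (hH : IsComponentOf G {t | t ≠ u ∧ t ≠ v} H)
    (hHV : ∀ t ∈ P.support, t ∉ H) (hHE : ∀ e ∈ P.edges, e ∉ edgesWithin G H)
    (G₁ G₂ : G.Subgraph)
    (hV₁ : G₁.verts = decompVerts1 P H) (hE₁ : G₁.edgeSet = decompEdges1 P H)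
    (hV₂ : G₂.verts = Hᶜ) (hE₂ : G₂.edgeSet = edgesWithin G Hᶜ) :
    (∀ x y : V, x ∈ G₁.verts → y ∈ G₁.verts → y ∉ P.support →
      ∀ p : G.Walk x y, p.IsPath →
        (∀ t ∈ p.support, t ≠ x → t ≠ y → t ∈ G₁.verts ∧ t ≠ u ∧ t ≠ v) →
        WalkIn G₁.verts G₁.edgeSet p) ∧
    (∀ x y : V, x ∈ G₂.verts → y ∈ G₂.verts → y ∉ P.support →
      ∀ p : G.Walk x y, p.IsPath →
        (∀ t ∈ p.support, t ≠ x → t ≠ y → t ∈ G₂.verts ∧ t ≠ u ∧ t ≠ v) →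
        WalkIn G₂.verts G₂.edgeSet p) := by
  rw [hV₁, hE₁, hV₂, hE₂]
  constructor
  · intro x y hx hy hyP p hp hint
    have hyH : y ∈ H := hy.resolve_right hyP
    cases p with
    | nil => simpa [WalkIn] using hx
    | @cons _ b _ hxb q =>
      obtain ⟨-, hxq⟩ := (Walk.cons_isPath_iff _ _).1 hp
      have hqH : ∀ t ∈ q.support, t ∈ H := by
        refine hH.support_subset q hyH fun t ht => ?_
        by_cases hty : t = y
        · exact hty ▸ hH.2.1 hyH
        · exact (hint t (by simp [ht]) (by rintro rfl; exact hxq ht) hty).2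
      have hbH : b ∈ H := hqH b q.start_mem_support
      refine ⟨?_, ?_⟩
      · simp only [Walk.support_cons, List.mem_cons, forall_eq_or_imp]
        exact ⟨hx, fun t ht => Or.inl (hqH t ht)⟩
      · simp only [Walk.edges_cons, List.mem_cons, forall_eq_or_imp]
        refine ⟨?_, fun e he => Or.inl (Or.inl (edges_subset_edgesWithin q hqH e he))⟩
        by_cases hxuv : x = u ∨ x = v
        · exact Or.inr ⟨b, hbH, x, hxuv, hxb.symm, Sym2.eq_swap⟩
        · have hxH : x ∈ H := hH.mem_of_adj hxb (not_or.1 hxuv) hbH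
          refine Or.inl (Or.inl ⟨hxb, ?_⟩)
          simp [hxH, hbH]
  · intro x y hx hy _ p _ hint
    have hsupp : ∀ t ∈ p.support, t ∈ Hᶜ := by
      intro t ht
      by_cases htx : t = x
      · exact htx ▸ hx
      by_cases hty : t = y
      · exact hty ▸ hy
      exact (hint t ht htx hty).1
    exact ⟨hsupp, edges_subset_edgesWithin p hsupp⟩

end LexMCB
end
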